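/- Let P be a full-support joint distribution on Ω, fix Y ∈ ι and Π ⊆ ι \ {Y}. For any function g : F Y × (Π_{i ∈ Π} F i) → ℝ with g > 0 and Σ_{y ∈ F Y} g(y, p) = 1 for every p, define the joint distribution Q_g on Ω by Q_g(x) = P_{ι\{Y}}(x restricted to ι\{Y}) · g(x_Y, x restricted to Π). Then D_KL(P ‖ Q_g) is minimized over all such g by the choice g = P[{Y} | Π]: for every admissible g, D_KL(P ‖ Q_g) ≥ D_KL(P ‖ Q_{P[{Y}|Π]}), with equality if and only if g(y, p) = P[{Y} | Π](y | p) for all (y, p) with P_Π(p) > 0. -/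

import Mathlib

open scoped BigOperators

namespace CausalPre

variable {ι : Type*} [Fintype ι] [DecidableEq ι]
variable {F : ι → Type*} [∀ i, Fintype (F i)] [∀ i, DecidableEq (F i)]
  [∀ i, Nonempty (F i)]

/-- Restriction of a full configuration to the coordinates in `S`. -/
def restrict (S : Finset ι) (x : ∀ i, F i) : ∀ i : S, F i := fun i => x i

/-- `P` is a joint distribution on `Ω = Π i, F i`. -/
def IsJoint (P : (∀ i, F i) → ℝ) : Prop :=
  (∀ x, 0 ≤ P x) ∧ ∑ x, P x = 1

/-- `P` has full support. -/
def FullSupport (P : (∀ i, F i) → ℝ) : Prop := ∀ x, 0 < P x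

/-- Marginal of `P` on the coordinates in `S`. -/
noncomputable def marginal (P : (∀ i, F i) → ℝ) (S : Finset ι)
    (s : ∀ i : S, F i) : ℝ :=
  ∑ x : ∀ i, F i, if restrict S x = s then P x else 0

/-- Conditional probability `P[T | S]`, evaluated at the restrictions of a full
configuration `x`:  `P[T | S](x_T | x_S) = P_{S ∪ T}(x_{S ∪ T}) / P_S(x_S)`. -/
noncomputable def condProb (P : (∀ i, F i) → ℝ) (T S : Finset ι)
    (x : ∀ i, F i) : ℝ :=
  marginal P (S ∪ T) (restrict (S ∪ T) x) / marginal P S (restrict S x)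

/-- Entropy of the marginal of `P` on `S`. -/
noncomputable def entropy (P : (∀ i, F i) → ℝ) (S : Finset ι) : ℝ :=
  -∑ s : ∀ i : S, F i, marginal P S s * Real.log (marginal P S s)

/-- Mutual information `I(S ; T)` of disjoint `S`, `T`. -/
noncomputable def mutualInfo (P : (∀ i, F i) → ℝ) (S T : Finset ι) : ℝ :=
  entropy P S + entropy P T - entropy P (S ∪ T)

/-- Conditional entropy `H(S | T)` for disjoint `S`, `T`. -/
noncomputable def condEntropy (P : (∀ i, F i) → ℝ) (S T : Finset ι) : ℝ :=
  entropy P (S ∪ T) - entropy P T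

/-- Conditional mutual information `I(S ; T | U)` of pairwise disjoint `S`, `T`, `U`. -/
noncomputable def condMutualInfo (P : (∀ i, F i) → ℝ) (S T U : Finset ι) : ℝ :=
  entropy P (S ∪ U) + entropy P (T ∪ U) - entropy P (S ∪ T ∪ U) - entropy P U

/-- Kullback–Leibler divergence `D_KL(P ‖ Q) = Σ_{x : P(x) > 0} P(x) log (P(x)/Q(x))`. -/
noncomputable def klDiv (P Q : (∀ i, F i) → ℝ) : ℝ :=
  ∑ x, if 0 < P x then P x * Real.log (P x / Q x) else 0

/-- Marginal of `P` on `Π ∪ {Y}`, with the value at `Y` and the values on `Π`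
given separately: `P_{Π ∪ {Y}}(p, y)`. -/
noncomputable def marginalYP (P : (∀ i, F i) → ℝ) (Y : ι) (Pi : Finset ι)
    (y : F Y) (p : ∀ i : Pi, F i) : ℝ :=
  ∑ x : ∀ i, F i, if x Y = y ∧ restrict Pi x = p then P x else 0

/-- Conditional distribution `P[{Y} | Π](y | p) = P_{Π ∪ {Y}}(p, y) / P_Π(p)`. -/
noncomputable def condYgivenParents (P : (∀ i, F i) → ℝ) (Y : ι) (Pi : Finset ι)
    (y : F Y) (p : ∀ i : Pi, F i) : ℝ :=
  marginalYP P Y Pi y p / marginal P Pi p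

/-- The factorized distribution
`Q_g(x) = P_{ι \ {Y}}(x_{ι \ {Y}}) · g(x_Y, x_Π)`. -/
noncomputable def factorDist (P : (∀ i, F i) → ℝ) (Y : ι) (Pi : Finset ι)
    (g : F Y → (∀ i : Pi, F i) → ℝ) (x : ∀ i, F i) : ℝ :=
  marginal P (Finset.univ \ {Y}) (restrict (Finset.univ \ {Y}) x)
    * g (x Y) (restrict Pi x)

/-- The expectation under `P` of a function of `(x_Y, x_Π)` is computed by `P_{Π ∪ {Y}}`. -/
lemma sum_mul_eq_sum_marginalYP (P : (∀ i, F i) → ℝ) (Y : ι) (Pi : Finset ι)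
    (f : F Y → (∀ i : Pi, F i) → ℝ) :
    ∑ x, P x * f (x Y) (restrict Pi x) = ∑ p, ∑ y, marginalYP P Y Pi y p * f y p := by
  simp only [marginalYP, Finset.sum_mul, ite_mul, zero_mul]
  rw [Finset.sum_congr rfl fun p _ => Finset.sum_comm, Finset.sum_comm]
  refine Finset.sum_congr rfl fun x _ => ?_
  rw [Finset.sum_eq_single (restrict Pi x), Finset.sum_eq_single (x Y)]
  · simp
  · intro y _ hy
    simp [hy.symm]
  · simp
  · intro p _ hp
    simp [hp.symm]
  · simp

lemma sum_marginalYP (P : (∀ i, F i) → ℝ) (Y : ι) (Pi : Finset ι) (p : ∀ i : Pi, F i) :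
    ∑ y, marginalYP P Y Pi y p = marginal P Pi p := by
  simp only [marginalYP, marginal]
  rw [Finset.sum_comm]
  refine Finset.sum_congr rfl fun x _ => ?_
  rw [Finset.sum_eq_single (x Y)]
  · simp
  · intro y _ hy
    simp [hy.symm]
  · simp

lemma marginalYP_pos {P : (∀ i, F i) → ℝ} (hfull : FullSupport P) {Y : ι} {Pi : Finset ι}
    (hPi : Y ∉ Pi) (y : F Y) (p : ∀ i : Pi, F i) : 0 < marginalYP P Y Pi y p := by
  classical
  let z : ∀ i, F i := fun i => if h : i ∈ Pi then p ⟨i, h⟩ else Classical.arbitrary (F i)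
  refine Finset.sum_pos' (fun x _ => ?_) ⟨Function.update z Y y, Finset.mem_univ _, ?_⟩
  · split_ifs
    exacts [(hfull x).le, le_rfl]
  · rw [if_pos]
    · exact hfull _
    · refine ⟨Function.update_self .., funext fun i => ?_⟩
      have hi : (i : ι) ≠ Y := fun h => hPi (h ▸ i.2)
      simp [restrict, Function.update_of_ne hi, z]

lemma marginal_restrict_pos {P : (∀ i, F i) → ℝ} (hfull : FullSupport P) (S : Finset ι)
    (x : ∀ i, F i) : 0 < marginal P S (restrict S x) := by
  refine Finset.sum_pos' (fun z _ => ?_) ⟨x, Finset.mem_univ _, ?_⟩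
  · split_ifs
    exacts [(hfull z).le, le_rfl]
  · simpa using hfull x

lemma marginal_pos {P : (∀ i, F i) → ℝ} (hfull : FullSupport P) (S : Finset ι)
    (s : ∀ i : S, F i) : 0 < marginal P S s := by
  classical
  let z : ∀ i, F i := fun i => if h : i ∈ S then s ⟨i, h⟩ else Classical.arbitrary (F i)
  have hz : restrict S z = s := funext fun i => by simp [restrict, z]
  exact hz ▸ marginal_restrict_pos hfull S z

lemma condYgivenParents_pos {P : (∀ i, F i) → ℝ} (hfull : FullSupport P) {Y : ι}
    {Pi : Finset ι} (hPi : Y ∉ Pi) (y : F Y) (p : ∀ i : Pi, F i) :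
    0 < condYgivenParents P Y Pi y p :=
  div_pos (marginalYP_pos hfull hPi y p) (marginal_pos hfull Pi p)

lemma klDiv_factorDist_sub {P : (∀ i, F i) → ℝ} (hfull : FullSupport P) {Y : ι}
    {Pi : Finset ι} {g c : F Y → (∀ i : Pi, F i) → ℝ}
    (hg : ∀ y p, 0 < g y p) (hc : ∀ y p, 0 < c y p) :
    klDiv P (factorDist P Y Pi g) - klDiv P (factorDist P Y Pi c)
      = ∑ p, ∑ y, marginalYP P Y Pi y p * Real.log (c y p / g y p) := by
  rw [← sum_mul_eq_sum_marginalYP P Y Pi fun y p => Real.log (c y p / g y p), klDiv, klDiv,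
    ← Finset.sum_sub_distrib]
  refine Finset.sum_congr rfl fun x _ => ?_
  have hm := (marginal_restrict_pos hfull (Finset.univ \ {Y}) x).ne'
  have hgx := (hg (x Y) (restrict Pi x)).ne'
  have hcx := (hc (x Y) (restrict Pi x)).ne'
  have hx := (hfull x).ne'
  rw [if_pos (hfull x), if_pos (hfull x), factorDist, factorDist,
    Real.log_div hx (mul_ne_zero hm hgx), Real.log_div hx (mul_ne_zero hm hcx),
    Real.log_mul hm hgx, Real.log_mul hm hcx, Real.log_div hcx hgx]
  ring

/-- The excess divergence of `Q_g` is the `P_Π`-average of the divergences of `P[{Y} | Π]`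
from `g`. -/
lemma klDiv_factorDist_sub_condYgivenParents {P : (∀ i, F i) → ℝ} (hfull : FullSupport P)
    {Y : ι} {Pi : Finset ι} (hPi : Y ∉ Pi) {g : F Y → (∀ i : Pi, F i) → ℝ}
    (hg0 : ∀ y p, 0 < g y p) (hg1 : ∀ p, ∑ y, g y p = 1) :
    klDiv P (factorDist P Y Pi g) - klDiv P (factorDist P Y Pi (condYgivenParents P Y Pi))
      = ∑ p, ∑ y, marginal P Pi p * g y p *
          InformationTheory.klFun (condYgivenParents P Y Pi y p / g y p) := by
  rw [klDiv_factorDist_sub hfull hg0 (condYgivenParents_pos hfull hPi)]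
  refine Finset.sum_congr rfl fun p _ => ?_
  have hterm : ∀ y, marginal P Pi p * g y p *
        InformationTheory.klFun (condYgivenParents P Y Pi y p / g y p)
      = marginalYP P Y Pi y p * Real.log (condYgivenParents P Y Pi y p / g y p)
        + (marginal P Pi p * g y p - marginalYP P Y Pi y p) := by
    intro y
    have hm : marginalYP P Y Pi y p = marginal P Pi p * condYgivenParents P Y Pi y p :=
      (mul_div_cancel₀ _ (marginal_pos hfull Pi p).ne').symm
    have hgy := (hg0 y p).ne'
    rw [hm, InformationTheory.klFun]
    field_simp
    ring
  simp_rw [hterm]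
  rw [Finset.sum_add_distrib, Finset.sum_sub_distrib, ← Finset.mul_sum, hg1, sum_marginalYP]
  ring

/-- For a full-support joint distribution `P`, a label
`Y ∈ ι` and `Π ⊆ ι \ {Y}`: among all positive row-stochastic kernels `g`,
the KL divergence `D_KL(P ‖ Q_g)` is minimized by `g = P[{Y} | Π]`, with
equality iff `g(y, p) = P[{Y} | Π](y | p)` whenever `P_Π(p) > 0`. -/
theorem klDiv_factorDist_minimized_by_conditional
    (P : (∀ i, F i) → ℝ) (hP : IsJoint P) (hfull : FullSupport P)
    (Y : ι) (Pi : Finset ι) (hPi : Y ∉ Pi)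
    (g : F Y → (∀ i : Pi, F i) → ℝ)
    (hg0 : ∀ y p, 0 < g y p) (hg1 : ∀ p, ∑ y, g y p = 1) :
    klDiv P (factorDist P Y Pi (condYgivenParents P Y Pi))
        ≤ klDiv P (factorDist P Y Pi g)
      ∧ (klDiv P (factorDist P Y Pi g)
            = klDiv P (factorDist P Y Pi (condYgivenParents P Y Pi)) ↔
          ∀ (y : F Y) (p : ∀ i : Pi, F i), 0 < marginal P Pi p →
            g y p = condYgivenParents P Y Pi y p) := by
  have hsub := klDiv_factorDist_sub_condYgivenParents hfull hPi hg0 hg1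
  have hratio : ∀ y p, 0 < condYgivenParents P Y Pi y p / g y p := fun y p =>
    div_pos (condYgivenParents_pos hfull hPi y p) (hg0 y p)
  have hweight : ∀ y p, 0 < marginal P Pi p * g y p := fun y p =>
    mul_pos (marginal_pos hfull Pi p) (hg0 y p)
  have hnonneg : ∀ y p, 0 ≤ marginal P Pi p * g y p *
      InformationTheory.klFun (condYgivenParents P Y Pi y p / g y p) := fun y p =>
    mul_nonneg (hweight y p).le (InformationTheory.klFun_nonneg (hratio y p).le)
  have hzero : ∀ y p, marginal P Pi p * g y p *
      InformationTheory.klFun (condYgivenParents P Y Pi y p / g y p) = 0 ↔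
        g y p = condYgivenParents P Y Pi y p := by
    intro y p
    rw [mul_eq_zero, or_iff_right (hweight y p).ne',
      InformationTheory.klFun_eq_zero_iff (hratio y p).le, div_eq_one_iff_eq (hg0 y p).ne',
      eq_comm]
  refine ⟨sub_nonneg.1 ?_, ?_⟩
  · rw [hsub]
    exact Finset.sum_nonneg fun p _ => Finset.sum_nonneg fun y _ => hnonneg y p
  · rw [← sub_eq_zero, hsub,
      Finset.sum_eq_zero_iff_of_nonneg fun p _ => Finset.sum_nonneg fun y _ => hnonneg y p]
    simp only [Finset.sum_eq_zero_iff_of_nonneg fun y _ => hnonneg y _, Finset.mem_univ,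
      true_imp_iff, hzero, marginal_pos hfull]
    exact forall_comm

end CausalPre
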